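/- For every integer q ≥ 5, the border rank of the Kronecker cube of the little Coppersmith–Winograd tensor equals (q+2)³: R̲(T_{cw,q}^{⊠3}) = (q+2)³. -/

import Mathlib

open scoped BigOperators

noncomputable section

/-- A 3-tensor in coordinates has rank at most `r`. -/
def rankLE {ι₁ ι₂ ι₃ : Type*} (T : ι₁ → ι₂ → ι₃ → ℂ) (r : ℕ) : Prop :=
  ∃ (x : Fin r → ι₁ → ℂ) (y : Fin r → ι₂ → ℂ) (z : Fin r → ι₃ → ℂ),
    ∀ i j k, T i j k = ∑ ℓ, x ℓ i * y ℓ j * z ℓ k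

/-- Border rank at most `r`: membership in the closure of tensors of rank at most `r`. -/
def borderRankLE {ι₁ ι₂ ι₃ : Type*} (T : ι₁ → ι₂ → ι₃ → ℂ) (r : ℕ) : Prop :=
  T ∈ closure {T' : ι₁ → ι₂ → ι₃ → ℂ | rankLE T' r}

/-- The border rank of a 3-tensor. -/
def borderRank {ι₁ ι₂ ι₃ : Type*} (T : ι₁ → ι₂ → ι₃ → ℂ) : ℕ :=
  sInf {r | borderRankLE T r}

/-- The little Coppersmith–Winograd tensor `T_{cw,q}` in coordinates. -/
def Tcw (q : ℕ) : Fin (q + 1) → Fin (q + 1) → Fin (q + 1) → ℂ :=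
  fun i j k =>
    (if i.val = 0 ∧ j = k ∧ 1 ≤ j.val then 1 else 0) +
    (if j.val = 0 ∧ i = k ∧ 1 ≤ i.val then 1 else 0) +
    (if k.val = 0 ∧ i = j ∧ 1 ≤ i.val then 1 else 0)

/-- The Kronecker cube `T_{cw,q}^{⊠3}` in coordinates. -/
def TcwCube (q : ℕ) :
    (Fin (q+1) × Fin (q+1) × Fin (q+1)) → (Fin (q+1) × Fin (q+1) × Fin (q+1)) →
      (Fin (q+1) × Fin (q+1) × Fin (q+1)) → ℂ :=
  fun i j k => Tcw q i.1 j.1 k.1 * Tcw q i.2.1 j.2.1 k.2.1 * Tcw q i.2.2 j.2.2 k.2.2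

/-- The nonzero entries `(d, t, s)` in row `p` of the Koszul map `x ↦ x ∧ ·` from `Λ²` to `Λ³` of a
five-dimensional space: the entry in column `t` contains `s * x d`. -/
def kos : ℕ → List (ℕ × ℕ × ℤ)
  | 0 => [(2, 0, 1), (3, 1, 1), (4, 4, 1)]
  | 1 => [(1, 0, -1), (3, 2, 1), (4, 5, 1)]
  | 2 => [(0, 0, 1), (3, 3, 1), (4, 6, 1)]
  | 3 => [(1, 1, -1), (2, 2, -1), (4, 7, 1)]
  | 4 => [(0, 1, 1), (2, 3, -1), (4, 8, 1)]
  | 5 => [(0, 2, 1), (1, 3, 1), (4, 9, 1)]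
  | 6 => [(1, 4, -1), (2, 5, -1), (3, 7, -1)]
  | 7 => [(0, 4, 1), (2, 6, -1), (3, 8, -1)]
  | 8 => [(0, 5, 1), (1, 6, 1), (3, 9, -1)]
  | 9 => [(0, 7, 1), (1, 8, 1), (2, 9, 1)]
  | _ => []

/-- The supports of five vectors (with all coefficients one) in the cube of the six-dimensional
coordinate space; they span the restriction of the first tensor factor. -/
def mons : ℕ → List (ℕ × ℕ × ℕ)
  | 0 => [(0, 0, 0)]
  | 1 => [(0, 0, 2), (0, 4, 0), (1, 1, 4), (1, 5, 0), (4, 0, 0)]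
  | 2 => [(0, 0, 1), (0, 1, 4), (1, 0, 4), (2, 0, 0), (3, 0, 3), (3, 2, 1), (3, 5, 1), (4, 5, 1),
      (5, 3, 0)]
  | 3 => [(0, 2, 0), (0, 5, 2), (1, 0, 0), (1, 3, 3), (2, 0, 3), (4, 1, 0), (5, 5, 3)]
  | 4 => [(0, 0, 5), (0, 1, 1), (0, 3, 0), (0, 4, 4), (1, 2, 5), (3, 2, 0), (4, 3, 3), (5, 0, 2),
      (5, 5, 4)]
  | _ => []

/-- The index paired with `j` by the slice `a` of the Coppersmith–Winograd tensor, or the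
out-of-range value `7` if there is none. -/
def stepIdx (a j : ℕ) : ℕ :=
  bif Nat.beq a 0 then (bif Nat.beq j 0 then 7 else j)
  else bif Nat.beq j 0 then a else bif Nat.beq j a then 0 else 7

/-- The local digits of a block: a single digit `6` or the six core digits. -/
def digits (b : Bool) : List ℕ := bif b then [6] else [0, 1, 2, 3, 4, 5]

/-- Membership in `digits b`. -/
def legit (b : Bool) (x : ℕ) : Bool := bif b then Nat.beq x 6 else Nat.blt x 6

/-- The bit position of a column. The lowest 64 bits of a row only serve to diversify hashes. -/
def colCode (t : ℕ) (k : ℕ × ℕ × ℕ) : ℕ := 5183 - (((k.1 * 8 + k.2.1) * 8 + k.2.2) * 10 + t)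

def termBit (b : Bool × Bool × Bool) (i m : ℕ × ℕ × ℕ) (t : ℕ) : ℕ :=
  bif legit b.1 (stepIdx m.1 i.1) && (legit b.2.1 (stepIdx m.2.1 i.2.1) &&
    legit b.2.2 (stepIdx m.2.2 i.2.2))
  then 1 <<< colCode t (stepIdx m.1 i.1, stepIdx m.2.1 i.2.1, stepIdx m.2.2 i.2.2) else 0

def xorSum : List ℕ → ℕ
  | [] => 0
  | a :: l => Nat.xor a (xorSum l)

/-- A row of the Koszul flattening modulo two, as a bit vector. -/
def rowCode (b : Bool × Bool × Bool) (p : ℕ) (i : ℕ × ℕ × ℕ) : ℕ :=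
  Nat.xor (Nat.mod ((((p * 8 + i.1) * 8 + i.2.1) * 8 + i.2.2) * 11400714819323198485) (2 ^ 64)) <|
    xorSum ((kos p).map fun e => xorSum ((mons e.1).map fun m => termBit b i m e.2.1))

def rowCodes (b : Bool × Bool × Bool) : List ℕ :=
  [0, 1, 2, 3, 4, 5, 6, 7, 8, 9].flatMap fun p => (digits b.1).flatMap fun i₀ =>
    (digits b.2.1).flatMap fun i₁ => (digits b.2.2).map fun i₂ => rowCode b p (i₀, i₁, i₂)

/-- Binary search trees storing values `v` under keys `k`. -/
inductive Trie
  | nil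
  | node (k v : ℕ) (l r : Trie)

/-- Application, evaluating the argument first under kernel reduction. -/
def force {α : Type} (n : ℕ) (f : ℕ → α) : α :=
  Nat.rec (f 0) (fun k _ => f (Nat.succ k)) n

def Trie.find (t : Trie) (k : ℕ) : ℕ :=
  Trie.rec 0 (fun k' v _ _ fl fr =>
    Bool.rec (Bool.rec fr fl (Nat.ble k k')) v (Nat.beq k k')) t

def Trie.insert {α : Type} (k v : ℕ) (t : Trie) : (Trie → α) → α :=
  Trie.rec (fun c => c (node k v nil nil)) (fun k' v' l r fl fr c =>
    Bool.rec (fr fun r => c (node k' v' l r)) (fl fun l => c (node k' v' l r)) (Nat.ble k k')) t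

/-- The lowest bit of `v`, as a power of two. -/
def lowBit (v : ℕ) : ℕ := Nat.land v (Nat.xor v (Nat.sub v 1))

def pivot (v : ℕ) : ℕ := lowBit (Nat.shiftRight v 64)

/-- Reduce `v` by the rows stored in `t`; a power of two is stored under its residue modulo `5147`,
for which `2` is a primitive root. -/
def reduceRow (t : Trie) (n : ℕ) : ℕ → ℕ :=
  Nat.rec (fun v => v) (fun _ ih v => Nat.rec 0 (fun v _ =>
      Nat.rec v.succ (fun w _ => ih (Nat.xor v.succ w.succ))
        (Nat.rec 0 (fun h _ => t.find h.succ) (Nat.mod (pivot v.succ) 5147))) v) n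

/-- Gaussian elimination modulo two, counting the pivots found. The pivots already used are recorded
in the bit mask `u`. -/
def rankLoop (l : List ℕ) : Trie → ℕ → ℕ → ℕ :=
  List.rec (fun _ _ c => c) (fun v _ ih t u c =>
    force (reduceRow t 3000 v) fun v => force (pivot v) fun h =>
      bif Nat.beq h 0 then ih t u c else bif Nat.beq (Nat.land u h) 0 then
        force (Nat.lor u h) fun u => force (Nat.succ c) fun c =>
        force (Nat.mod h 5147) fun h => t.insert h v fun t => ih t u c
      else ih t u c) l

/-- The contribution of a block to the size of the minor. -/
def sz (b : Bool) : ℕ := bif b then 1 else 7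

set_option maxRecDepth 100000 in
theorem rankLoop_rowCodes (b : Bool × Bool × Bool) :
    rankLoop (rowCodes b) .nil 0 0 = 6 * (sz b.1 * (sz b.2.1 * sz b.2.2)) := by
  apply Nat.eq_of_beq_eq_true
  revert b
  simp only [Prod.forall, Bool.forall_bool]
  refine ⟨⟨⟨?_, ?_⟩, ?_, ?_⟩, ⟨?_, ?_⟩, ?_, ?_⟩ <;> decide +kernel

theorem force_eq {α : Type} (n : ℕ) (f : ℕ → α) : force n f = f n := by cases n <;> rfl

theorem exists_lowBit (v : ℕ) (hv : v ≠ 0) :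
    ∃ j, lowBit v = 2 ^ j ∧ v.testBit j = true ∧ ∀ c < j, v.testBit c = false := by
  induction v using Nat.strong_induction_on with
  | _ v ih =>
    rcases Nat.even_or_odd' v with ⟨y, rfl | rfl⟩
    · obtain ⟨j, h₁, h₂, h₃⟩ := ih y (by omega) (by omega)
      refine ⟨j + 1, ?_, ?_, ?_⟩
      · rw [pow_succ', ← h₁]
        change (2 * y) &&& ((2 * y) ^^^ (2 * y - 1)) = 2 * (y &&& (y ^^^ (y - 1)))
        obtain ⟨z, rfl⟩ : ∃ z, y = z + 1 := ⟨y - 1, by omega⟩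
        have e : 2 * (z + 1) - 1 = 2 * z + 1 := by omega
        rw [e, Nat.add_sub_cancel]
        apply Nat.eq_of_testBit_eq
        intro i
        cases i with
        | zero => simp
        | succ i =>
          have e₁ : (2 * z + 1) / 2 = z := by omega
          have e₂ : 2 * (z + 1) / 2 = z + 1 := by omega
          have e₃ (x : ℕ) : 2 * x / 2 = x := by omega
          rw [Nat.testBit_and, Nat.testBit_xor]
          simp only [Nat.testBit_succ, e₁, e₂, e₃, Nat.testBit_and, Nat.testBit_xor]
      · rw [Nat.testBit_succ]; simpa using h₂
      · intro c hc
        cases c with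
        | zero => simp
        | succ c => rw [Nat.testBit_succ]; simpa using h₃ c (by omega)
    · refine ⟨0, ?_, by simp, by simp⟩
      change (2 * y + 1) &&& ((2 * y + 1) ^^^ (2 * y + 1 - 1)) = 2 ^ 0
      apply Nat.eq_of_testBit_eq
      intro i
      cases i with
      | zero => simp
      | succ i =>
        have e₁ : (2 * y + 1) / 2 = y := by omega
        have e₂ : 2 * y / 2 = y := by omega
        rw [Nat.testBit_and, Nat.testBit_xor]
        simp [Nat.testBit_succ, e₁, e₂]

namespace Trie

/-- Every value stored in the tree satisfies `P`. -/
def All (P : ℕ → Prop) : Trie → Prop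
  | nil => True
  | node _ v l r => P v ∧ l.All P ∧ r.All P

theorem All.find {P : ℕ → Prop} {t : Trie} (ht : t.All P) (k : ℕ) :
    t.find k = 0 ∨ P (t.find k) := by
  induction t with
  | nil => exact Or.inl rfl
  | node k' v l r hl hr =>
    obtain ⟨hv, h₁, h₂⟩ := ht
    have : (node k' v l r).find k =
        bif Nat.beq k k' then v else bif Nat.ble k k' then l.find k else r.find k := by
      simp only [Trie.find]
      cases Nat.beq k k' <;> cases Nat.ble k k' <;> rfl
    rw [this]
    cases Nat.beq k k' <;> cases Nat.ble k k'
    exacts [hr h₂, hl h₁, Or.inr hv, Or.inr hv]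

theorem All.insert {P : ℕ → Prop} {t : Trie} (ht : t.All P) (k : ℕ) {v : ℕ} (hv : P v) :
    ∃ t' : Trie, t'.All P ∧ ∀ {α : Type} (c : Trie → α), t.insert k v c = c t' := by
  induction t with
  | nil => exact ⟨node k v nil nil, ⟨hv, trivial, trivial⟩, fun _ => rfl⟩
  | node k' v' l r hl hr =>
    obtain ⟨hv', h₁, h₂⟩ := ht
    obtain ⟨l', hl', el⟩ := hl h₁
    obtain ⟨r', hr', er⟩ := hr h₂
    have key : ∀ {α : Type} (c : Trie → α), (node k' v' l r).insert k v c =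
        bif Nat.ble k k' then l.insert k v fun l => c (node k' v' l r)
        else r.insert k v fun r => c (node k' v' l r) := by
      intro α c
      simp only [Trie.insert]
      cases Nat.ble k k' <;> rfl
    cases hk : Nat.ble k k'
    · refine ⟨node k' v' l r', ⟨hv', h₁, hr'⟩, fun c => ?_⟩
      rw [key, hk, cond_false, er]
    · refine ⟨node k' v' l' r, ⟨hv', hl', h₂⟩, fun c => ?_⟩
      rw [key, hk, cond_true, el]

end Trie

theorem reduceRow_induction {P : ℕ → Prop} (hx : ∀ v w, P v → P w → P (v ^^^ w)) {t : Trie}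
    (ht : t.All P) (n : ℕ) {v : ℕ} (hv : P v) :
    reduceRow t n v = 0 ∨ P (reduceRow t n v) := by
  induction n generalizing v with
  | zero => exact Or.inr hv
  | succ n ih =>
    cases v with
    | zero => exact Or.inl rfl
    | succ v =>
      have : reduceRow t (n + 1) (v + 1) = Nat.rec (v + 1)
          (fun w _ => reduceRow t n ((v + 1) ^^^ (w + 1)))
          (Nat.rec 0 (fun h _ => t.find h.succ) (Nat.mod (pivot (v + 1)) 5147)) := rfl
      rw [this]
      cases Nat.mod (pivot (v + 1)) 5147 with
      | zero => exact Or.inr hv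
      | succ h =>
        change (Nat.rec (v + 1) (fun w _ => reduceRow t n ((v + 1) ^^^ (w + 1)))
          (t.find (h + 1)) : ℕ) = 0 ∨ P (Nat.rec (v + 1)
            (fun w _ => reduceRow t n ((v + 1) ^^^ (w + 1))) (t.find (h + 1)))
        have hw := ht.find (h + 1)
        cases hf : t.find (h + 1) with
        | zero => exact Or.inr hv
        | succ w =>
          rw [hf] at hw
          exact ih (hx _ _ hv (hw.resolve_left (by omega)))

/-- The rows found by elimination: row `w h` for `h ∈ S` has its lowest relevant bit at `h`. -/
theorem exists_pivots {P : ℕ → Prop} (hx : ∀ v w, P v → P w → P (v ^^^ w)) (l : List ℕ)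
    (hl : ∀ v ∈ l, P v) :
    ∃ (S : Finset ℕ) (w : ℕ → ℕ), S.card = rankLoop l .nil 0 0 ∧
      ∀ h ∈ S, P (w h) ∧ (w h).testBit (64 + h) = true ∧
        ∀ c < h, (w h).testBit (64 + c) = false := by
  suffices H : ∀ (t : Trie) (u c : ℕ), t.All P → ∀ (S : Finset ℕ) (w : ℕ → ℕ), S.card = c →
      (∀ h ∈ S, u.testBit h = true ∧ P (w h) ∧ (w h).testBit (64 + h) = true ∧
        ∀ c < h, (w h).testBit (64 + c) = false) →
      ∃ (S : Finset ℕ) (w : ℕ → ℕ), S.card = rankLoop l t u c ∧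
        ∀ h ∈ S, P (w h) ∧ (w h).testBit (64 + h) = true ∧
          ∀ c < h, (w h).testBit (64 + c) = false from
    H .nil 0 0 trivial ∅ id rfl (by simp)
  induction l with
  | nil => exact fun t u c _ S w hc hS => ⟨S, w, hc, fun h hh => (hS h hh).2⟩
  | cons v l ih =>
    intro t u c ht S w hc hS
    have ih := ih fun v hv => hl v (List.mem_cons_of_mem _ hv)
    have step : rankLoop (v :: l) t u c =
        bif Nat.beq (pivot (reduceRow t 3000 v)) 0 then rankLoop l t u c
        else bif Nat.beq (Nat.land u (pivot (reduceRow t 3000 v))) 0 then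
          t.insert (Nat.mod (pivot (reduceRow t 3000 v)) 5147) (reduceRow t 3000 v) fun t' =>
            rankLoop l t' (Nat.lor u (pivot (reduceRow t 3000 v))) (c + 1)
        else rankLoop l t u c := by
      have : rankLoop (v :: l) t u c = force (reduceRow t 3000 v) fun v => force (pivot v) fun h =>
          bif Nat.beq h 0 then rankLoop l t u c else bif Nat.beq (Nat.land u h) 0 then
            force (Nat.lor u h) fun u => force (Nat.succ c) fun c =>
            force (Nat.mod h 5147) fun h => t.insert h v fun t => rankLoop l t u c
          else rankLoop l t u c := rfl
      rw [this]
      simp only [force_eq, Nat.succ_eq_add_one]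
    rw [step]
    have hr := reduceRow_induction hx ht 3000 (hl v List.mem_cons_self)
    generalize reduceRow t 3000 v = v' at hr ⊢
    cases h₁ : Nat.beq (pivot v') 0 with
    | true => exact ih t u c ht S w hc hS
    | false =>
      cases h₂ : Nat.beq (Nat.land u (pivot v')) 0 with
      | false => exact ih t u c ht S w hc hS
      | true =>
        have hp : pivot v' ≠ 0 := Nat.ne_of_beq_eq_false h₁
        have hv₀ : v' ≠ 0 := by rintro rfl; exact hp rfl
        have hv : P v' := hr.resolve_left hv₀
        have hs : v' >>> 64 ≠ 0 := by
          intro h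
          apply hp
          change lowBit (v' >>> 64) = 0
          rw [h]; rfl
        obtain ⟨j, hj, hj₁, hj₂⟩ := exists_lowBit _ hs
        change pivot v' = 2 ^ j at hj
        rw [hj] at h₂ ⊢
        have hu : u.testBit j = false := by
          have h₂ : u &&& 2 ^ j = 0 := Nat.eq_of_beq_eq_true h₂
          have := congrArg (fun x => x.testBit j) h₂
          simpa using this
        obtain ⟨t', ht', et⟩ := ht.insert (Nat.mod (2 ^ j) 5147) hv
        simp only [cond_false, cond_true, et]
        have hjS : j ∉ S := fun h => by simp [(hS j h).1] at hu
        refine ih t' _ _ ht' (insert j S) (Function.update w j v')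
          (by rw [Finset.card_insert_of_notMem hjS, hc]) fun h hh => ?_
        change (u ||| 2 ^ j).testBit h = true ∧ _
        rcases Finset.mem_insert.1 hh with rfl | hh
        · simp only [Function.update_self]
          refine ⟨by simp, hv, ?_, fun c hc => ?_⟩
          · simpa using hj₁
          · simpa using hj₂ c hc
        · have : h ≠ j := fun e => hjS (e ▸ hh)
          rw [Function.update_of_ne this]
          exact ⟨by simp [(hS h hh).1], (hS h hh).2⟩

/-- The matrix of `x ∧ ·` from `Λ²` to `Λ³` of a five-dimensional space. -/
def koszul {R : Type*} [CommRing R] (x : ℕ → R) : Matrix (Fin 10) (Fin 10) R :=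
  Matrix.of fun p t => ((kos p).map fun e => if e.2.1 = (t : ℕ) then (e.2.2 : R) * x e.1 else 0).sum

abbrev Digit (b : Bool) : Type := ↥(digits b).toFinset

abbrev Digit3 (b : Bool × Bool × Bool) : Type := Digit b.1 × Digit b.2.1 × Digit b.2.2

def Digit3.val {b : Bool × Bool × Bool} (i : Digit3 b) : ℕ × ℕ × ℕ := (i.1, i.2.1, i.2.2)

def stepIdx3 (m i : ℕ × ℕ × ℕ) : ℕ × ℕ × ℕ :=
  (stepIdx m.1 i.1, stepIdx m.2.1 i.2.1, stepIdx m.2.2 i.2.2)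

/-- The core block of the Koszul flattening. -/
def coreMatrix (R : Type*) [CommRing R] (b : Bool × Bool × Bool) :
    Matrix (Fin 10 × Digit3 b) (Fin 10 × Digit3 b) R :=
  Matrix.of fun r c => koszul (fun d => ((mons d).map fun m =>
    if stepIdx3 m r.2.val = c.2.val then (1 : R) else 0).sum) r.1 c.1

theorem map_koszul {R S : Type*} [CommRing R] [CommRing S] (f : R →+* S) (x : ℕ → R)
    (p t : Fin 10) : f (koszul x p t) = koszul (fun d => f (x d)) p t := by
  simp only [koszul, Matrix.of_apply, map_list_sum, List.map_map]
  congr 2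
  funext e
  simp only [Function.comp_apply]
  split_ifs <;> simp

theorem map_coreMatrix {R S : Type*} [CommRing R] [CommRing S] (f : R →+* S)
    (b : Bool × Bool × Bool) : (coreMatrix R b).map f = coreMatrix S b := by
  ext r c
  simp only [Matrix.map_apply, coreMatrix, Matrix.of_apply, map_koszul, map_list_sum, List.map_map]
  congr 1
  funext d
  congr 2
  funext m
  simp only [Function.comp_apply]
  split_ifs <;> simp

/-- Bit `c` of `v` modulo two. -/
def bitZ (c v : ℕ) : ZMod 2 := if v.testBit c = true then 1 else 0

theorem bitZ_xor (c v w : ℕ) : bitZ c (v ^^^ w) = bitZ c v + bitZ c w := by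
  simp only [bitZ, Nat.testBit_xor]
  cases v.testBit c <;> cases w.testBit c <;> decide

theorem bitZ_xorSum (c : ℕ) (l : List ℕ) : bitZ c (xorSum l) = (l.map (bitZ c)).sum := by
  induction l with
  | nil => simp [xorSum, bitZ]
  | cons a l ih => rw [List.map_cons, List.sum_cons, ← ih]; exact bitZ_xor c a (xorSum l)

theorem sum_list_sum {α β M : Type*} [AddCommMonoid M] (s : Finset β) (l : List α)
    (f : α → β → M) : ∑ x ∈ s, (l.map fun a => f a x).sum = (l.map fun a => ∑ x ∈ s, f a x).sum := by
  induction l with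
  | nil => simp
  | cons a l ih => simp [Finset.sum_add_distrib, ih]

theorem kos_spec : ∀ (p : Fin 10), ∀ e ∈ kos p, e.2.1 < 10 ∧ (e.2.2 : ZMod 2) = 1 := by decide

theorem mem_digits_iff (b : Bool) (x : ℕ) : x ∈ (digits b).toFinset ↔ legit b x = true := by
  cases b
  · simp [digits, legit]
    omega
  · simp [digits, legit]

theorem sum_termBit (b : Bool × Bool × Bool) (i : Digit3 b) (m : ℕ × ℕ × ℕ) {t : ℕ} (ht : t < 10)
    (c : ℕ) :
    (∑ x : Fin 10 × Digit3 b, if t = (x.1 : ℕ) then if stepIdx3 m i.val = x.2.val then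
      if colCode x.1 x.2.val = c then (1 : ZMod 2) else 0 else 0 else 0) =
      bitZ c (termBit b i.val m t) := by
  rw [termBit, Bool.cond_eq_ite]
  split_ifs with h
  · simp only [Bool.and_eq_true, ← mem_digits_iff] at h
    rw [Finset.sum_eq_single (⟨t, ht⟩, ⟨_, h.1⟩, ⟨_, h.2.1⟩, ⟨_, h.2.2⟩)]
    · simp [stepIdx3, Digit3.val, bitZ, Nat.one_shiftLeft, Nat.testBit_two_pow]
      congr
    · rintro ⟨t', k₀, k₁, k₂⟩ - hne
      split_ifs with h₁ h₂ h₃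
      · exfalso
        apply hne
        simp only [stepIdx3, Digit3.val, Prod.mk.injEq] at h₂
        simp only [Prod.mk.injEq, Subtype.ext_iff, Fin.ext_iff]
        exact ⟨h₁.symm, h₂.1.symm, h₂.2.1.symm, h₂.2.2.symm⟩
      all_goals rfl
    · simp
  · rw [Finset.sum_eq_zero]
    · simp [bitZ]
    · rintro ⟨t', k₀, k₁, k₂⟩ -
      split_ifs with h₁ h₂ h₃
      · exfalso
        apply h
        simp only [stepIdx3, Digit3.val, Prod.mk.injEq] at h₂
        simp only [Bool.and_eq_true, ← mem_digits_iff]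
        exact ⟨h₂.1 ▸ k₀.2, h₂.2.1 ▸ k₁.2, h₂.2.2 ▸ k₂.2⟩
      all_goals rfl

theorem sum_coreMatrix (b : Bool × Bool × Bool) (r : Fin 10 × Digit3 b) {c : ℕ} (hc : 64 ≤ c) :
    ∑ x, coreMatrix (ZMod 2) b r x * (if colCode x.1 x.2.val = c then 1 else 0) =
      bitZ c (rowCode b r.1 r.2.val) := by
  have h₀ : bitZ c (rowCode b r.1 r.2.val) = bitZ c (xorSum ((kos r.1).map fun e =>
      xorSum ((mons e.1).map fun m => termBit b r.2.val m e.2.1))) := by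
    refine (bitZ_xor _ _ _).trans ?_
    rw [bitZ, if_neg, zero_add]
    rw [Nat.testBit_lt_two_pow]
    · simp
    · exact (Nat.mod_lt _ (by norm_num)).trans_le (Nat.pow_le_pow_right (by norm_num) hc)
  rw [h₀, bitZ_xorSum, List.map_map]
  simp only [coreMatrix, koszul, Matrix.of_apply, ← List.sum_map_mul_right]
  rw [sum_list_sum]
  congr 1
  refine List.map_congr_left fun e he => ?_
  obtain ⟨h₁, h₂⟩ := kos_spec _ e he
  simp only [Function.comp_apply, bitZ_xorSum, List.map_map]
  have : ((mons e.1).map (bitZ c ∘ fun m => termBit b r.2.val m e.2.1)) =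
      (mons e.1).map fun m => ∑ x : Fin 10 × Digit3 b, if e.2.1 = (x.1 : ℕ) then
        if stepIdx3 m r.2.val = x.2.val then
        if colCode x.1 x.2.val = c then (1 : ZMod 2) else 0 else 0 else 0 :=
    List.map_congr_left fun m _ => (sum_termBit b r.2 m h₁ c).symm
  rw [this, ← sum_list_sum]
  refine Finset.sum_congr rfl fun x _ => ?_
  rw [h₂, one_mul]
  split_ifs <;> simp

theorem exists_det_coreMatrix_ne_zero (b : Bool × Bool × Bool) :
    ∃ (S : Finset ℕ) (L : Matrix S (Fin 10 × Digit3 b) ℤ) (R : Matrix (Fin 10 × Digit3 b) S ℤ),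
      S.card = 6 * (sz b.1 * (sz b.2.1 * sz b.2.2)) ∧ (L * coreMatrix ℤ b * R).det ≠ 0 := by
  let P : ℕ → Prop := fun v => ∃ l : Fin 10 × Digit3 b → ZMod 2,
    ∀ c, 64 ≤ c → bitZ c v = ∑ r, l r * bitZ c (rowCode b r.1 r.2.val)
  obtain ⟨S, w, hS, hw⟩ := exists_pivots (P := P) (by
      rintro v w ⟨l, hl⟩ ⟨l', hl'⟩
      refine ⟨l + l', fun c hc => ?_⟩
      simp only [bitZ_xor, hl c hc, hl' c hc, Pi.add_apply, add_mul, Finset.sum_add_distrib])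
    (rowCodes b) (by
      intro v hv
      simp only [rowCodes, List.mem_flatMap, List.mem_map] at hv
      obtain ⟨p, hp, i₀, h₀, i₁, h₁, i₂, h₂, rfl⟩ := hv
      refine ⟨Pi.single (⟨p, ?_⟩, ⟨i₀, by simpa using h₀⟩, ⟨i₁, by simpa using h₁⟩,
        ⟨i₂, by simpa using h₂⟩) 1, fun c _ => ?_⟩
      · simp at hp
        omega
      · rw [Finset.sum_eq_single_of_mem _ (Finset.mem_univ _)
          (fun r _ hr => by rw [Pi.single_eq_of_ne hr, zero_mul])]
        simp [Digit3.val])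
  choose! l hl using fun h hh => (hw h hh).1
  refine ⟨S, Matrix.of fun h r => (l h r).val,
    Matrix.of fun x h => if colCode x.1 x.2.val = 64 + h then 1 else 0,
    hS.trans (rankLoop_rowCodes b), fun hdet => ?_⟩
  have h₂ := congrArg (Int.castRingHom (ZMod 2)) hdet
  rw [RingHom.map_det, RingHom.mapMatrix_apply, Matrix.map_mul, Matrix.map_mul, map_coreMatrix,
    map_zero] at h₂
  have key : ∀ i j : S,
      ((Matrix.of fun (h : S) r => ((l h r).val : ℤ)).map (Int.castRingHom (ZMod 2)) *
      coreMatrix (ZMod 2) b * (Matrix.of fun (x : Fin 10 × Digit3 b) (h : S) =>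
        if colCode x.1 x.2.val = 64 + h then (1 : ℤ) else 0).map (Int.castRingHom (ZMod 2))) i j =
      bitZ (64 + j) (w i) := by
    intro i j
    rw [hl i i.2 _ (by omega), Matrix.mul_assoc, Matrix.mul_apply]
    refine Finset.sum_congr rfl fun r _ => ?_
    rw [← sum_coreMatrix b r (by omega : 64 ≤ 64 + (j : ℕ)), Matrix.mul_apply]
    congr 1
    · simp [Matrix.map_apply]
    · refine Finset.sum_congr rfl fun x _ => ?_
      simp only [Matrix.map_apply, Matrix.of_apply]
      split_ifs <;> simp
  rw [Matrix.det_of_isUpperTriangular, Finset.prod_eq_one] at h₂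
  · exact one_ne_zero h₂
  · intro i _
    rw [key, bitZ, if_pos (hw i i.2).2.1]
  · intro i j hij
    rw [key, bitZ, (hw i i.2).2.2 j hij]
    simp

/-- The pairs avoiding `c`. -/
def avoidPair : Fin 5 → Fin 6 → Fin 10 :=
  ![![2, 4, 5, 7, 8, 9], ![1, 3, 5, 6, 8, 9], ![0, 3, 4, 6, 7, 9],
    ![0, 1, 2, 6, 7, 8], ![0, 1, 2, 3, 4, 5]]

/-- The triples obtained by adjoining `c` to the pairs avoiding it. -/
def joinTriple : Fin 5 → Fin 6 → Fin 10 :=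
  ![![0, 1, 2, 4, 5, 7], ![0, 1, 3, 4, 6, 8], ![0, 2, 3, 5, 6, 9],
    ![1, 2, 3, 7, 8, 9], ![4, 5, 6, 7, 8, 9]]

/-- The signs of these triples under exterior multiplication by `c`. -/
def joinSign : Fin 5 → Fin 6 → ℤ :=
  ![![1, 1, 1, 1, 1, 1], ![-1, -1, 1, -1, 1, 1], ![1, -1, -1, -1, -1, 1],
    ![1, 1, 1, -1, -1, -1], ![1, 1, 1, 1, 1, 1]]

/-- The coefficient of `x a` in `koszul x p t`. -/
def koszulCoeff (p t : Fin 10) (a : Fin 5) : ℤ :=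
  ((kos p).map fun e => if e.2.1 = (t : ℕ) ∧ e.1 = (a : ℕ) then e.2.2 else 0).sum

theorem koszul_eq_sum {R : Type*} [CommRing R] (x : ℕ → R) (p t : Fin 10) :
    koszul x p t = ∑ a : Fin 5, (koszulCoeff p t a : R) * x a := by
  have hk : ∀ p : Fin 10, ∀ e ∈ kos p, e.1 < 5 := by decide
  simp only [koszulCoeff, Int.cast_list_sum, List.map_map, ← List.sum_map_mul_right, sum_list_sum]
  rw [koszul, Matrix.of_apply]
  congr 1
  refine List.map_congr_left fun e he => ?_
  rw [Finset.sum_eq_single ⟨e.1, hk p e he⟩]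
  · simp only [Function.comp_apply, and_true]
    split_ifs <;> simp
  · intro a _ ha
    have : e.1 ≠ (a : ℕ) := fun h => ha (Fin.ext h.symm)
    simp [this]
  · simp

/-- `x ∧ ι_c (x ∧ ω) = x_c • (x ∧ ω)`, where `ι_c` is contraction by the `c`-th coordinate. -/
theorem mul_koszul {R : Type*} [CommRing R] [CharZero R] [NoZeroDivisors R] (x : ℕ → R) (c : Fin 5)
    (p t : Fin 10) : x c * koszul x p t =
      ∑ s, koszul x p (joinTriple c s) * joinSign c s * koszul x (avoidPair c s) t := by
  let q : Fin 5 → Fin 5 → ℤ := fun a b => (if a = c then koszulCoeff p t b else 0) -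
    ∑ s, koszulCoeff p (joinTriple c s) a * joinSign c s * koszulCoeff (avoidPair c s) t b
  have hq : ∀ a b, q a b + q b a = 0 := by
    have : ∀ (c : Fin 5) (p t : Fin 10) (a b : Fin 5),
        ((if a = c then koszulCoeff p t b else 0) - ∑ s, koszulCoeff p (joinTriple c s) a *
          joinSign c s * koszulCoeff (avoidPair c s) t b) +
        ((if b = c then koszulCoeff p t a else 0) - ∑ s, koszulCoeff p (joinTriple c s) b *
          joinSign c s * koszulCoeff (avoidPair c s) t a) = 0 := by
      decide +kernel
    exact this c p t
  have hsum : x c * koszul x p t -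
      ∑ s, koszul x p (joinTriple c s) * joinSign c s * koszul x (avoidPair c s) t =
      ∑ a, ∑ b, (q a b : R) * (x a * x b) := by
    simp only [koszul_eq_sum, q, Int.cast_sub, Int.cast_sum, Int.cast_mul, sub_mul,
      Finset.sum_sub_distrib, Int.cast_ite, Int.cast_zero, ite_mul, zero_mul]
    congr 1
    · simp only [Finset.mul_sum]
      rw [Finset.sum_comm]
      refine Finset.sum_congr rfl fun b _ => ?_
      rw [Finset.sum_ite_eq' Finset.univ c, if_pos (Finset.mem_univ c)]
      ring
    · simp only [Finset.sum_mul (ι := Fin 6)]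
      rw [Finset.sum_congr rfl fun a _ => Finset.sum_comm, Finset.sum_comm]
      refine Finset.sum_congr rfl fun s _ => ?_
      rw [mul_right_comm, Finset.sum_mul_sum, Finset.sum_mul]
      refine Finset.sum_congr rfl fun a _ => ?_
      rw [Finset.sum_mul]
      refine Finset.sum_congr rfl fun b _ => ?_
      ring
  have h2 : (2 : R) * ∑ a, ∑ b, (q a b : R) * (x a * x b) = 0 := by
    rw [two_mul]
    nth_rewrite 2 [Finset.sum_comm]
    simp only [← Finset.sum_add_distrib]
    refine Finset.sum_eq_zero fun a _ => Finset.sum_eq_zero fun b _ => ?_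
    rw [mul_comm (x b), ← add_mul, ← Int.cast_add, hq, Int.cast_zero, zero_mul]
  rw [← sub_eq_zero, hsum]
  exact (mul_eq_zero.1 h2).resolve_left two_ne_zero

/-- For every `x`, the matrix `koszul x` factors through a six-dimensional space. -/
theorem exists_koszul_eq_mul (x : ℕ → ℂ) : ∃ (C : Fin 10 → Fin 6 → ℂ) (D : Fin 6 → Fin 10 → ℂ),
    ∀ p t, koszul x p t = ∑ s, C p s * D s t := by
  by_cases h : ∃ c : Fin 5, x c ≠ 0
  · obtain ⟨c, hc⟩ := h
    refine ⟨fun p s => (x c)⁻¹ * (koszul x p (joinTriple c s) * joinSign c s),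
      fun s t => koszul x (avoidPair c s) t, fun p t => ?_⟩
    simp only [mul_assoc (x c)⁻¹]
    rw [← Finset.mul_sum, ← mul_koszul, inv_mul_cancel_left₀ hc]
  · push Not at h
    exact ⟨0, 0, fun p t => by simp [koszul_eq_sum, h]⟩

/-- The Koszul flattening of a tensor restricted, in the first factor, to the span of the five
vectors with supports `M 0, …, M 4`. -/
def koszulFlattening {ι J K : Type*} (M : ℕ → List ι) (T : ι → J → K → ℂ) :
    Matrix (Fin 10 × J) (Fin 10 × K) ℂ :=
  Matrix.of fun r c => koszul (fun d => ((M d).map fun i => T i r.2 c.2).sum) r.1 c.1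

theorem exists_koszulFlattening_eq {ι J K : Type*} (M : ℕ → List ι) {T : ι → J → K → ℂ} {r : ℕ}
    (hT : rankLE T r) : ∃ (A : Matrix (Fin 10 × J) (Fin r × Fin 6) ℂ)
      (B : Matrix (Fin r × Fin 6) (Fin 10 × K) ℂ), koszulFlattening M T = A * B := by
  obtain ⟨x, y, z, h⟩ := hT
  choose C D hCD using fun ℓ => exists_koszul_eq_mul fun d => ((M d).map (x ℓ)).sum
  refine ⟨Matrix.of fun a b => C b.1 a.1 b.2 * y b.1 a.2,
    Matrix.of fun b c => D b.1 b.2 c.1 * z b.1 c.2, ?_⟩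
  ext ⟨p, j⟩ ⟨t, k⟩
  have hsum : ∀ d, ((M d).map fun i => T i j k).sum =
      ∑ ℓ, ((M d).map (x ℓ)).sum * (y ℓ j * z ℓ k) := fun d => by
    simp only [h, ← List.sum_map_mul_right, sum_list_sum, mul_assoc]
  simp only [koszulFlattening, Matrix.of_apply, hsum, Matrix.mul_apply, Fintype.sum_prod_type]
  trans ∑ ℓ, koszul (fun d => ((M d).map (x ℓ)).sum) p t * (y ℓ j * z ℓ k)
  · simp only [koszul_eq_sum, Finset.mul_sum, Finset.sum_mul]
    rw [Finset.sum_comm]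
    simp only [mul_assoc]
  · refine Finset.sum_congr rfl fun ℓ _ => ?_
    rw [hCD, Finset.sum_mul]
    refine Finset.sum_congr rfl fun s _ => ?_
    ring

theorem continuous_koszulFlattening {ι J K : Type*} (M : ℕ → List ι) :
    Continuous (koszulFlattening (J := J) (K := K) M) := by
  refine continuous_matrix fun r c => ?_
  simp only [koszulFlattening, Matrix.of_apply, koszul_eq_sum]
  refine continuous_finsetSum _ fun a _ => continuous_const.mul ?_
  refine continuous_list_sum _ fun i _ => ?_
  fun_prop

theorem det_mul_eq_zero_of_card_lt {m k : Type*} [Fintype m] [DecidableEq m] [Fintype k]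
    (A : Matrix m k ℂ) (B : Matrix k m ℂ) (h : Fintype.card k < Fintype.card m) :
    (A * B).det = 0 := by
  by_contra hne
  have h1 := Matrix.rank_of_isUnit (A * B) ((Matrix.isUnit_iff_isUnit_det _).2 (Ne.isUnit hne))
  have h2 := (Matrix.rank_mul_le_left A B).trans (Matrix.rank_le_card_width A)
  omega

/-- The lower bound on border rank given by a nonzero minor of a Koszul flattening. -/
theorem card_le_of_borderRankLE {ι J K m u v : Type*} [Fintype m] [DecidableEq m] [Fintype u]
    [Fintype v] (M : ℕ → List ι) {T : ι → J → K → ℂ} {r : ℕ} (hT : borderRankLE T r)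
    (e : u → Fin 10 × J) (f : v → Fin 10 × K) (L : Matrix m u ℂ) (R : Matrix v m ℂ)
    (hdet : (L * (koszulFlattening M T).submatrix e f * R).det ≠ 0) :
    Fintype.card m ≤ 6 * r := by
  by_contra! hlt
  let g : (ι → J → K → ℂ) → ℂ := fun T => (L * (koszulFlattening M T).submatrix e f * R).det
  have hg : Continuous g :=
    ((continuous_const.matrix_mul ((continuous_koszulFlattening M).matrix_submatrix e f)).matrix_mul
      continuous_const).matrix_det
  have hsub : {T' : ι → J → K → ℂ | rankLE T' r} ⊆ g ⁻¹' {0} := by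
    intro T' hT'
    obtain ⟨A, B, hAB⟩ := exists_koszulFlattening_eq M hT'
    have h := det_mul_eq_zero_of_card_lt (L * A.submatrix e id) (B.submatrix id f * R)
      (by simpa [mul_comm] using hlt)
    rw [Set.mem_preimage, Set.mem_singleton_iff, ← h]
    simp only [g]
    rw [hAB, ← Matrix.submatrix_mul_equiv A B e (Equiv.refl _) f]
    simp only [Matrix.mul_assoc, Equiv.coe_refl]
  exact hdet (closure_minimal hsub (isClosed_singleton.preimage hg) hT)

/-- The inclusion of the local digits of a block: the block `none` has index set `{0, …, 5}`, and
the block `some j` has index set `{6 + j}`. -/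
def embed {n : ℕ} : ∀ o : Option (Fin n), Digit o.isSome → Fin (n + 5 + 1)
  | none, i => ⟨i, by have := i.2; simp [digits] at this; omega⟩
  | some j, _ => ⟨6 + j, by omega⟩

theorem Tcw_embed {n : ℕ} {a : ℕ} (ha : a < 6) (o o' : Option (Fin n)) (j : Digit o.isSome)
    (k : Digit o'.isSome) : Tcw (n + 5) (Fin.ofNat (n + 5 + 1) a) (embed o j) (embed o' k) =
      if o = o' ∧ stepIdx a j = k then 1 else 0 := by
  have hmod : a % (n + 5 + 1) = a := Nat.mod_eq_of_lt (by omega)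
  have hj := (mem_digits_iff _ _).1 j.2
  have hk := (mem_digits_iff _ _).1 k.2
  obtain ⟨j, hj'⟩ := j
  obtain ⟨k, hk'⟩ := k
  rcases o with _ | o <;> rcases o' with _ | o' <;>
    simp only [legit, Option.isSome_none, Option.isSome_some, cond_true, cond_false, Nat.blt_eq,
      Nat.beq_eq] at hj hk <;>
    simp only [Tcw, embed, stepIdx, Fin.ext_iff, Fin.val_ofNat, hmod, Bool.cond_eq_ite,
      Nat.beq_eq,
      Option.some.injEq, reduceCtorEq, true_and, false_and, if_false]
  all_goals split_ifs <;> first | omega | simp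

abbrev isSome3 {α : Type*} (o : Option α × Option α × Option α) : Bool × Bool × Bool :=
  (o.1.isSome, o.2.1.isSome, o.2.2.isSome)

def embed3 {n : ℕ} (o : Option (Fin n) × Option (Fin n) × Option (Fin n)) (i : Digit3 (isSome3 o)) :
    Fin (n + 5 + 1) × Fin (n + 5 + 1) × Fin (n + 5 + 1) :=
  (embed o.1 i.1, embed o.2.1 i.2.1, embed o.2.2 i.2.2)

theorem lt_of_mem_mons {d : ℕ} {m : ℕ × ℕ × ℕ} (hm : m ∈ mons d) :
    m.1 < 6 ∧ m.2.1 < 6 ∧ m.2.2 < 6 := by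
  have h : ∀ d < 5, ∀ m ∈ mons d, m.1 < 6 ∧ m.2.1 < 6 ∧ m.2.2 < 6 := by decide
  rcases lt_or_ge d 5 with hd | hd
  · exact h d hd m hm
  · obtain ⟨d, rfl⟩ := Nat.exists_eq_add_of_le' hd
    simp [mons] at hm

theorem TcwCube_embed3 {n : ℕ} {d : ℕ} {m : ℕ × ℕ × ℕ} (hm : m ∈ mons d)
    (o o' : Option (Fin n) × Option (Fin n) × Option (Fin n)) (j : Digit3 (isSome3 o))
    (k : Digit3 (isSome3 o')) : TcwCube (n + 5) (Fin.ofNat (n + 5 + 1) m.1,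
      Fin.ofNat (n + 5 + 1) m.2.1, Fin.ofNat (n + 5 + 1) m.2.2) (embed3 o j) (embed3 o' k) =
      if o = o' ∧ stepIdx3 m j.val = k.val then 1 else 0 := by
  obtain ⟨h₀, h₁, h₂⟩ := lt_of_mem_mons hm
  simp only [TcwCube, embed3, Tcw_embed h₀, Tcw_embed h₁, Tcw_embed h₂, ite_zero_mul_ite_zero,
    mul_one, Prod.ext_iff, stepIdx3, Digit3.val]
  refine if_congr ?_ rfl rfl
  tauto

/-- The Koszul flattening of the Kronecker cube is block diagonal. -/
theorem koszulFlattening_TcwCube_submatrix (n : ℕ) :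
    (koszulFlattening (fun d => (mons d).map fun m => (Fin.ofNat (n + 5 + 1) m.1,
      Fin.ofNat (n + 5 + 1) m.2.1, Fin.ofNat (n + 5 + 1) m.2.2)) (TcwCube (n + 5))).submatrix
      (fun x : Σ o : Option (Fin n) × Option (Fin n) × Option (Fin n), Fin 10 × Digit3 (isSome3 o) =>
        (x.2.1, embed3 x.1 x.2.2)) (fun x => (x.2.1, embed3 x.1 x.2.2)) =
    Matrix.blockDiagonal' fun o => coreMatrix ℂ (isSome3 o) := by
  ext ⟨o, p, j⟩ ⟨o', t, k⟩
  simp only [koszulFlattening, Matrix.submatrix_apply, Matrix.of_apply, List.map_map]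
  have h : ∀ d, ((mons d).map ((fun i => TcwCube (n + 5) i (embed3 o j) (embed3 o' k)) ∘ fun m =>
      (Fin.ofNat (n + 5 + 1) m.1, Fin.ofNat (n + 5 + 1) m.2.1, Fin.ofNat (n + 5 + 1) m.2.2))).sum =
      ((mons d).map fun m => if o = o' ∧ stepIdx3 m j.val = k.val then (1 : ℂ) else 0).sum :=
    fun d => congrArg List.sum (List.map_congr_left fun m hm => TcwCube_embed3 hm o o' j k)
  simp only [h]
  by_cases ho : o = o'
  · subst ho
    simp [coreMatrix]
  · rw [Matrix.blockDiagonal'_apply_ne _ _ _ ho]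
    simp [ho, koszul_eq_sum]

theorem det_blockDiagonal'_ne_zero {o : Type*} [Fintype o] [DecidableEq o] {m : o → Type*}
    [∀ i, Fintype (m i)] [∀ i, DecidableEq (m i)] (M : ∀ i, Matrix (m i) (m i) ℂ)
    (h : ∀ i, (M i).det ≠ 0) : (Matrix.blockDiagonal' M).det ≠ 0 := by
  rw [← isUnit_iff_ne_zero, ← Matrix.isUnit_iff_isUnit_det]
  refine IsUnit.map (Matrix.blockDiagonal'RingHom m ℂ) (Pi.isUnit_iff.2 fun i => ?_)
  exact (Matrix.isUnit_iff_isUnit_det _).2 (isUnit_iff_ne_zero.2 (h i))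

theorem le_of_borderRankLE_TcwCube (n : ℕ) {r : ℕ} (hr : borderRankLE (TcwCube (n + 5)) r) :
    (n + 7) ^ 3 ≤ r := by
  choose S L R hS hdet using exists_det_coreMatrix_ne_zero
  have h := card_le_of_borderRankLE _ hr _ _
    (Matrix.blockDiagonal' fun o : Option (Fin n) × Option (Fin n) × Option (Fin n) =>
      (L (isSome3 o)).map (Int.castRingHom ℂ))
    (Matrix.blockDiagonal' fun o : Option (Fin n) × Option (Fin n) × Option (Fin n) =>
      (R (isSome3 o)).map (Int.castRingHom ℂ))
    (by
      rw [koszulFlattening_TcwCube_submatrix, ← Matrix.blockDiagonal'_mul,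
        ← Matrix.blockDiagonal'_mul]
      refine det_blockDiagonal'_ne_zero _ fun o => ?_
      rw [← map_coreMatrix (Int.castRingHom ℂ), ← Matrix.map_mul, ← Matrix.map_mul,
        ← RingHom.mapMatrix_apply, ← RingHom.map_det]
      simpa using hdet (isSome3 o))
  have hsz : ∑ o : Option (Fin n), sz o.isSome = n + 7 := by
    simp [Fintype.sum_option, sz, add_comm]
  simp only [Fintype.card_sigma, Fintype.card_coe, hS, ← Finset.mul_sum, Fintype.sum_prod_type,
    ← Finset.sum_mul, hsz] at h
  nlinarith [h]

theorem rankLE_card {ι J K κ : Type*} [Fintype κ] (x : κ → ι → ℂ) (y : κ → J → ℂ) (z : κ → K → ℂ) :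
    rankLE (fun i j k => ∑ ℓ, x ℓ i * y ℓ j * z ℓ k) (Fintype.card κ) := by
  let e := Fintype.equivFin κ
  refine ⟨fun ℓ => x (e.symm ℓ), fun ℓ => y (e.symm ℓ), fun ℓ => z (e.symm ℓ), fun i j k => ?_⟩
  exact (e.symm.sum_comp fun ℓ => x ℓ i * y ℓ j * z ℓ k).symm

/-- The Kronecker cube of a tensor, in coordinates. -/
def kroneckerCube {ι J K : Type*} (T : ι → J → K → ℂ) :
    ι × ι × ι → J × J × J → K × K × K → ℂ :=
  fun i j k => T i.1 j.1 k.1 * T i.2.1 j.2.1 k.2.1 * T i.2.2 j.2.2 k.2.2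

theorem rankLE.kroneckerCube {ι J K : Type*} {T : ι → J → K → ℂ} {r : ℕ} (hT : rankLE T r) :
    rankLE (kroneckerCube T) (r ^ 3) := by
  obtain ⟨x, y, z, h⟩ := hT
  have hcard : Fintype.card (Fin r × Fin r × Fin r) = r ^ 3 := by
    simp only [Fintype.card_prod, Fintype.card_fin]
    ring
  rw [← hcard]
  convert rankLE_card (κ := Fin r × Fin r × Fin r)
    (fun ℓ (i : ι × ι × ι) => x ℓ.1 i.1 * x ℓ.2.1 i.2.1 * x ℓ.2.2 i.2.2)
    (fun ℓ (j : J × J × J) => y ℓ.1 j.1 * y ℓ.2.1 j.2.1 * y ℓ.2.2 j.2.2)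
    (fun ℓ (k : K × K × K) => z ℓ.1 k.1 * z ℓ.2.1 k.2.1 * z ℓ.2.2 k.2.2) using 4 with i j k
  simp only [_root_.kroneckerCube, h, Fintype.sum_prod_type]
  rw [mul_assoc, Finset.sum_mul]
  refine Finset.sum_congr rfl fun a _ => ?_
  rw [Finset.sum_mul_sum, Finset.mul_sum]
  refine Finset.sum_congr rfl fun b _ => ?_
  rw [Finset.mul_sum]
  refine Finset.sum_congr rfl fun c _ => ?_
  ring

/-- A curve of tensors through `T_{cw,q}` at `ε = 0`, of rank at most `q + 2` for `ε ≠ 0`. -/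
def TcwCurve (q : ℕ) (ε : ℂ) : Fin (q + 1) → Fin (q + 1) → Fin (q + 1) → ℂ :=
  fun i j k => Tcw q i j k +
    ε * ((if i ≠ 0 ∧ i = j ∧ j = k then 1 else 0) - (if i = 0 ∧ j ≠ 0 ∧ k ≠ 0 then 1 else 0) -
      (if i ≠ 0 ∧ j = 0 ∧ k ≠ 0 then 1 else 0) - (if i ≠ 0 ∧ j ≠ 0 ∧ k = 0 then 1 else 0)) -
    ε ^ 3 * (if i ≠ 0 ∧ j ≠ 0 ∧ k ≠ 0 then 1 else 0)

theorem TcwCurve_zero (q : ℕ) : TcwCurve q 0 = Tcw q := by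
  funext i j k
  simp [TcwCurve]

theorem rankLE_TcwCurve (q : ℕ) {ε : ℂ} (hε : ε ≠ 0) : rankLE (TcwCurve q ε) (q + 2) := by
  let u : Fin q → Fin (q + 1) → ℂ := fun a => Fin.cons 1 (Pi.single a ε)
  let v : Fin (q + 1) → ℂ := Fin.cons 1 fun _ => ε ^ 2
  let w : Fin (q + 1) → ℂ := Fin.cons 1 0
  have hcard : Fintype.card (Option (Option (Fin q))) = q + 2 := by simp
  rw [← hcard]
  convert rankLE_card (κ := Option (Option (Fin q)))
    (fun ℓ => ℓ.elim ((ε⁻¹ ^ 3 - q * ε⁻¹ ^ 2) • w) fun ℓ =>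
      ℓ.elim (-ε⁻¹ ^ 3 • v) fun a => ε⁻¹ ^ 2 • u a)
    (fun ℓ => ℓ.elim w fun ℓ => ℓ.elim v u) (fun ℓ => ℓ.elim w fun ℓ => ℓ.elim v u)
    using 4 with i j k
  simp only [Fintype.sum_option, Option.elim, Pi.smul_apply, smul_eq_mul, TcwCurve, Tcw]
  cases i using Fin.cases <;> cases j using Fin.cases <;> cases k using Fin.cases <;>
    simp [u, v, w, Pi.single_apply, ite_and]
  all_goals try split_ifs
  all_goals first | (exfalso; simp_all; done) | (field_simp; try ring)

theorem borderRankLE_TcwCube (q : ℕ) : borderRankLE (TcwCube q) ((q + 2) ^ 3) := by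
  have hcont : Continuous fun ε => kroneckerCube (TcwCurve q ε) := by
    refine continuous_pi fun i => continuous_pi fun j => continuous_pi fun k => ?_
    simp only [kroneckerCube, TcwCurve]
    fun_prop
  have h : kroneckerCube (TcwCurve q 0) ∈ closure {T' | rankLE T' ((q + 2) ^ 3)} :=
    map_mem_closure (f := fun ε => kroneckerCube (TcwCurve q ε)) (s := {0}ᶜ) hcont (by simp)
      fun ε hε => (rankLE_TcwCurve q hε).kroneckerCube
  rwa [TcwCurve_zero] at h

/-- For every `q ≥ 5`, the border rank of the Kronecker cube of the little
Coppersmith–Winograd tensor equals `(q+2)³`. -/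
theorem borderRank_TcwCube (q : ℕ) (hq : 5 ≤ q) :
    borderRank (TcwCube q) = (q + 2) ^ 3 := by
  refine le_antisymm (Nat.sInf_le (borderRankLE_TcwCube q)) ?_
  obtain ⟨n, rfl⟩ := Nat.exists_eq_add_of_le' hq
  exact le_csInf ⟨_, borderRankLE_TcwCube (n + 5)⟩ fun r hr => le_of_borderRankLE_TcwCube n hr
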